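/- (Proposition 2, combined bound for the inexact IMHR algorithm) Let π and π̄ be everywhere-positive probability density functions on ℝ^d with π(x)/π̄(x) ≥ δ for all x ∈ ℝ^d, where δ > 0. Let q be a probability measure on ℝ^d such that the measure μ_π with density π is absolutely continuous with respect to q and such that ‖q − μ_π‖_TV ≤ ε for some ε ≥ 0. Define the kernel P̄(x, A) = ∫_A min(1, π̄(y)π(x)/(π̄(x)π(y))) q(dy) + 1_A(x) · (1 − ∫_{ℝ^d} min(1, π̄(z)π(x)/(π̄(x)π(z))) q(dz)), and assume C = ∫_{ℝ^d} (π̄/π) dq satisfies 0 < C < ∞. Then for every x ∈ ℝ^d and every integer k ≥ 0, ‖P̄^k(x,·) − μ_{π̄}‖_TV ≤ (1 − Cδ)^k + (1 + 1/(Cδ)) · ε/δ, where μ_{π̄} is the probability measure with density π̄. Moreover 1 − 2ε/δ ≤ C ≤ 1 + 2ε/δ. -/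

import Mathlib

open Real MeasureTheory ProbabilityTheory

/-- Total variation distance between two measures:
`‖μ − ν‖_TV = sup_B |μ(B) − ν(B)|`, the supremum over measurable sets `B`. -/
noncomputable def tvDist {X : Type*} [MeasurableSpace X] (μ ν : Measure X) : ℝ :=
  ⨆ B : {B : Set X // MeasurableSet B}, |(μ B.1).toReal - (ν B.1).toReal|

/-- The `k`-step transition kernel: `k`-fold composition of `P` with itself. -/
noncomputable def kIter {X : Type*} [MeasurableSpace X] (P : Kernel X X) : ℕ → Kernel X X
  | 0 => Kernel.id
  | (k + 1) => P ∘ₖ kIter P k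

theorem tv_bdd {X : Type*} [MeasurableSpace X] (μ ν : Measure X) [IsProbabilityMeasure μ]
    [IsProbabilityMeasure ν] :
    BddAbove (Set.range (fun B : {B : Set X // MeasurableSet B} =>
      |(μ B.1).toReal - (ν B.1).toReal|)) := by
  refine ⟨1, ?_⟩
  rintro _ ⟨B, rfl⟩
  have h1 : (μ B.1).toReal ≤ 1 := measureReal_le_one
  have h2 : (ν B.1).toReal ≤ 1 := measureReal_le_one
  have h3 : 0 ≤ (μ B.1).toReal := ENNReal.toReal_nonneg
  have h4 : 0 ≤ (ν B.1).toReal := ENNReal.toReal_nonneg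
  simp only [abs_le]
  constructor <;> linarith

theorem tv_integral {X : Type*} [MeasurableSpace X] (μ ν : Measure X) [IsProbabilityMeasure μ]
    [IsProbabilityMeasure ν] (ε : ℝ) (h : tvDist μ ν ≤ ε) (M : ℝ) (hM : 0 ≤ M) (f : X → ℝ)
    (hf : Measurable f) (h0 : ∀ x, 0 ≤ f x) (h1 : ∀ x, f x ≤ M) :
    |∫ x, f x ∂μ - ∫ x, f x ∂ν| ≤ M * ε := by
  have hi : ∀ (ρ : Measure X) [IsProbabilityMeasure ρ], Integrable f ρ := fun ρ _ =>
    Integrable.of_bound hf.aestronglyMeasurable M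
      (Filter.Eventually.of_forall fun x => by rw [Real.norm_of_nonneg (h0 x)]; exact h1 x)
  have key : ∀ (ρ : Measure X) [IsProbabilityMeasure ρ],
      ∫ x, f x ∂ρ = ∫ t in Set.Ioc 0 M, ρ.real {a | t ≤ f a} := fun ρ _ =>
    (hi ρ).integral_eq_integral_Ioc_meas_le (Filter.Eventually.of_forall h0)
      (Filter.Eventually.of_forall h1)
  have hint : ∀ (ρ : Measure X) [IsProbabilityMeasure ρ],
      Integrable (fun t => ρ.real {a | t ≤ f a}) (volume.restrict (Set.Ioc 0 M)) := by
    intro ρ _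
    have hanti : Antitone (fun t => ρ.real {a | t ≤ f a}) := fun s t hst =>
      measureReal_mono (fun a (ha : t ≤ f a) => le_trans hst ha)
    refine Integrable.of_bound hanti.measurable.aestronglyMeasurable 1
      (Filter.Eventually.of_forall fun t => ?_)
    rw [Real.norm_of_nonneg measureReal_nonneg]
    exact measureReal_le_one
  rw [key μ, key ν, ← integral_sub (hint μ) (hint ν), ← Real.norm_eq_abs]
  have := norm_setIntegral_le_of_norm_le_const (μ := (volume : Measure ℝ)) (s := Set.Ioc 0 M)
    (f := fun t => μ.real {a | t ≤ f a} - ν.real {a | t ≤ f a}) (C := ε) (by simp)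
    (fun t _ => by
      rw [Real.norm_eq_abs]
      exact (le_ciSup (tv_bdd μ ν) ⟨{a | t ≤ f a}, measurableSet_le measurable_const hf⟩).trans h)
  refine this.trans (le_of_eq ?_)
  simp [hM, mul_comm]

theorem kIter_succ' {X : Type*} [MeasurableSpace X] (P : Kernel X X) (k : ℕ) :
    kIter P (k + 1) = kIter P k ∘ₖ P := by
  induction k with
  | zero => simp [kIter]
  | succ k ih =>
    have h1 : kIter P (k + 1 + 1) = P ∘ₖ kIter P (k + 1) := rfl
    have h2 : kIter P (k + 1) = P ∘ₖ kIter P k := rfl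
    rw [h1, ih, ← Kernel.comp_assoc, ← h2, ih]

theorem kIter_markov {X : Type*} [MeasurableSpace X] (P : Kernel X X) [IsMarkovKernel P] (k : ℕ) :
    IsMarkovKernel (kIter P k) := by
  induction k with
  | zero => simp only [kIter]; infer_instance
  | succ k ih => simp only [kIter]; infer_instance

theorem kIter_inv {X : Type*} [MeasurableSpace X] (P : Kernel X X) (m : Measure X)
    (h : m.bind P = m) (k : ℕ) : m.bind (kIter P k) = m := by
  induction k with
  | zero => simp [kIter]
  | succ k ih =>
    simp only [kIter]
    rw [← Measure.comp_assoc, ih, h]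

theorem bind_real {X : Type*} [MeasurableSpace X] (P : Kernel X X) [IsMarkovKernel P]
    (m : Measure X) [IsFiniteMeasure m] (A : Set X) (hA : MeasurableSet A) :
    (m.bind P).real A = ∫ x, (P x).real A ∂m := by
  rw [measureReal_def, Measure.bind_apply hA P.aemeasurable]
  simp only [measureReal_def]
  rw [integral_toReal (P.measurable_coe hA).aemeasurable
    (Filter.Eventually.of_forall fun x => measure_lt_top _ _)]

theorem wd_real {X : Type*} [MeasurableSpace X] (q : Measure X) [IsProbabilityMeasure q]
    (w : X → ℝ) (hw : Measurable w) (h0 : ∀ x, 0 < w x) (hi : Integrable w q) 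
    (A : Set X) (hA : MeasurableSet A) :
    (q.withDensity (fun x => ENNReal.ofReal (w x))).real A = ∫ x in A, w x ∂q := by
  rw [measureReal_def, withDensity_apply _ hA, integral_eq_lintegral_of_nonneg_ae
    (Filter.Eventually.of_forall fun x => (h0 x).le) hw.aestronglyMeasurable]

theorem inv_m {X : Type*} [MeasurableSpace X] (q : Measure X) [IsProbabilityMeasure q]
    (w : X → ℝ) (hw : Measurable w) (h0 : ∀ x, 0 < w x) (B : ℝ) (hB : ∀ x, w x ≤ B)
    (P : Kernel X X) [IsMarkovKernel P]
    (hP : ∀ (x : X) (A : Set X), MeasurableSet A →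
      (P x A).toReal = (∫ y in A, min 1 (w y / w x) ∂q) +
          A.indicator (fun _ => (1 : ℝ)) x * (1 - ∫ z, min 1 (w z / w x) ∂q)) :
    (q.withDensity (fun x => ENNReal.ofReal (w x))).bind P =
      q.withDensity (fun x => ENNReal.ofReal (w x)) := by
  have hi : Integrable w q := Integrable.of_bound hw.aestronglyMeasurable B
      (Filter.Eventually.of_forall fun x => by rw [Real.norm_of_nonneg (h0 x).le]; exact hB x)
  haveI : IsFiniteMeasure (q.withDensity (fun x => ENNReal.ofReal (w x))) :=
    isFiniteMeasure_withDensity_ofReal hi.2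
  ext A hA
  rw [← ENNReal.toReal_eq_toReal_iff' (by finiteness) (by finiteness)]
  change Measure.real _ _ = Measure.real _ _
  rw [bind_real P _ A hA, wd_real q w hw h0 hi A hA]
  rw [integral_withDensity_eq_integral_toReal_smul (by fun_prop) (by simp)]
  have hs : ∀ (ρ : Measure (X × X)) [IsFiniteMeasure ρ],
      Integrable (fun z : X × X => min (w z.1) (w z.2)) ρ := fun ρ _ =>
    Integrable.of_bound (by fun_prop : Measurable _).aestronglyMeasurable B
      (Filter.Eventually.of_forall fun z => by
        rw [Real.norm_of_nonneg (le_min (h0 _).le (h0 _).le)]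
        exact (min_le_left _ _).trans (hB _))
  have hmul : ∀ x y, w x * min 1 (w y / w x) = min (w x) (w y) := by
    intro x y
    rw [mul_min_of_nonneg _ _ (h0 x).le, mul_one, mul_div_cancel₀ _ (h0 x).ne']
  have hpt : ∀ x, (ENNReal.ofReal (w x)).toReal • (P x).real A =
      (∫ y in A, min (w x) (w y) ∂q) +
        A.indicator (fun x => w x - ∫ y, min (w x) (w y) ∂q) x := by
    intro x
    rw [ENNReal.toReal_ofReal (h0 x).le, measureReal_def, hP x A hA, smul_eq_mul, mul_add,
      ← integral_const_mul]
    simp only [hmul]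
    congr 1
    by_cases hx : x ∈ A
    · simp only [Set.indicator_of_mem hx, one_mul, mul_sub, mul_one, ← integral_const_mul, hmul]
    · simp [Set.indicator_of_notMem hx]
  simp only [hpt]
  have hI1 : Integrable (fun x => ∫ y in A, min (w x) (w y) ∂q) q :=
    (hs (q.prod (q.restrict A))).integral_prod_left
  have hI2 : Integrable (fun x => ∫ y, min (w x) (w y) ∂q) q :=
    (hs (q.prod q)).integral_prod_left
  have hI3 : Integrable (A.indicator (fun x => w x - ∫ y, min (w x) (w y) ∂q)) q :=
    (hi.sub hI2).indicator hA
  rw [integral_add hI1 hI3, integral_indicator hA,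
    integral_sub hi.integrableOn hI2.integrableOn,
    integral_integral_swap (hs (q.prod (q.restrict A)))]
  simp only [min_comm]
  have : ∫ y in A, ∫ x, min (w x) (w y) ∂q ∂q = ∫ x in A, ∫ y, min (w x) (w y) ∂q ∂q := by
    simp only [min_comm]
  linarith

theorem contraction {X : Type*} [MeasurableSpace X] (q : Measure X) [IsProbabilityMeasure q]
    (w : X → ℝ) (hw : Measurable w) (h0 : ∀ x, 0 < w x) (δ : ℝ) (hδ : 0 < δ)
    (hB : ∀ x, δ * w x ≤ 1)
    (P : Kernel X X) [IsMarkovKernel P]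
    (hP : ∀ (x : X) (A : Set X), MeasurableSet A →
      (P x A).toReal = (∫ y in A, min 1 (w y / w x) ∂q) +
          A.indicator (fun _ => (1 : ℝ)) x * (1 - ∫ z, min 1 (w z / w x) ∂q))
    (C : ℝ) (hC : C = ∫ x, w x ∂q) (hCpos : 0 < C) (A : Set X) (hA : MeasurableSet A) (k : ℕ) :
    ∀ x, |(kIter P k x).real A - (∫ x in A, w x ∂q) / C| ≤ (1 - C * δ) ^ k := by
  have hB' : ∀ x, w x ≤ 1 / δ := fun x => by rw [le_div_iff₀ hδ]; linarith [hB x]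
  have hi : Integrable w q := Integrable.of_bound hw.aestronglyMeasurable (1 / δ)
      (Filter.Eventually.of_forall fun x => by rw [Real.norm_of_nonneg (h0 x).le]; exact hB' x)
  have hinv := inv_m q w hw h0 (1 / δ) hB' P hP
  set m := q.withDensity (fun x => ENNReal.ofReal (w x)) with hm
  haveI : IsFiniteMeasure m := isFiniteMeasure_withDensity_ofReal hi.2
  have hmA : ∀ A, MeasurableSet A → m.real A = ∫ x in A, w x ∂q := wd_real q w hw h0 hi
  have hmuniv : m.real Set.univ = C := by rw [hmA _ .univ, hC]; simp
  have hmle : m.real A ≤ C := by rw [← hmuniv]; exact measureReal_mono (Set.subset_univ _)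
  rw [← hmA A hA]
  -- minorization
  have hmin : ∀ x, ENNReal.ofReal δ • m ≤ P x := by
    intro x
    refine Measure.le_iff.2 fun S hS => ?_
    have hfin : (ENNReal.ofReal δ • m) S ≠ ⊤ := by
      rw [Measure.smul_apply, smul_eq_mul]; finiteness
    rw [← ENNReal.toReal_le_toReal hfin (by finiteness), hP x S hS]
    have hmi : Integrable (fun y => min 1 (w y / w x)) q :=
      Integrable.of_bound (by fun_prop : Measurable _).aestronglyMeasurable 1
        (Filter.Eventually.of_forall fun y => by
          rw [Real.norm_of_nonneg (le_min zero_le_one (div_pos (h0 _) (h0 _)).le)]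
          exact min_le_left _ _)
    have e1 : ((ENNReal.ofReal δ • m) S).toReal = ∫ y in S, δ * w y ∂q := by
      rw [integral_const_mul, ← hmA S hS]
      simp [measureReal_def, hδ.le]
    rw [e1]
    have e2 : ∫ y in S, δ * w y ∂q ≤ ∫ y in S, min 1 (w y / w x) ∂q := by
      refine integral_mono (hi.const_mul δ).integrableOn hmi.integrableOn fun y => ?_
      refine le_min (hB y) ?_
      rw [le_div_iff₀ (h0 x)]
      nlinarith [hB x, h0 y]
    have e3 : ∫ z, min 1 (w z / w x) ∂q ≤ 1 := by
      have := integral_mono hmi (integrable_const (1 : ℝ)) (fun y => min_le_left 1 (w y / w x))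
      simpa using this
    have e4 : 0 ≤ S.indicator (fun _ => (1 : ℝ)) x :=
      Set.indicator_nonneg (fun _ _ => zero_le_one) _
    have := mul_nonneg e4 (sub_nonneg.2 e3)
    linarith
  induction k with
  | zero =>
    intro x
    haveI := kIter_markov P 0
    have a1 : (kIter P 0 x).real A ≤ 1 := measureReal_le_one
    have a2 : 0 ≤ (kIter P 0 x).real A := measureReal_nonneg
    have a3 : m.real A / C ≤ 1 := by rw [div_le_one hCpos]; exact hmle
    have a4 : 0 ≤ m.real A / C := div_nonneg measureReal_nonneg hCpos.le
    rw [pow_zero, abs_le]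
    constructor <;> linarith
  | succ k ih =>
    intro x
    haveI := kIter_markov P k
    have hg : Measurable (fun y => (kIter P k y).real A) :=
      ((kIter P k).measurable_coe hA).ennreal_toReal
    set g : X → ℝ := fun y => (kIter P k y).real A with hgdef
    set c := (1 - C * δ) ^ k with hc
    set a := m.real A / C with ha
    have hgi : ∀ (ρ : Measure X) [IsFiniteMeasure ρ], Integrable g ρ := fun ρ _ =>
      Integrable.of_bound hg.aestronglyMeasurable 1
        (Filter.Eventually.of_forall fun y => by
          rw [Real.norm_of_nonneg measureReal_nonneg]; exact measureReal_le_one)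
    have hstep : (kIter P (k + 1) x).real A = ∫ y, g y ∂(P x) := by
      rw [kIter_succ', Kernel.comp_apply, bind_real (kIter P k) (P x) A hA]
    have hgm : ∫ y, g y ∂m = m.real A := by
      rw [← bind_real (kIter P k) m A hA, kIter_inv P m hinv k]
    have hac : a * C = m.real A := div_mul_cancel₀ _ hCpos.ne'
    have mono : ∀ f : X → ℝ, (∀ y, 0 ≤ f y) → Integrable f (P x) →
        δ * ∫ y, f y ∂m ≤ ∫ y, f y ∂(P x) := by
      intro f hf hfi
      have := integral_mono_measure (hmin x) (Filter.Eventually.of_forall hf) hfi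
      rwa [integral_smul_measure, ENNReal.toReal_ofReal hδ.le, smul_eq_mul] at this
    have ih' := fun y => abs_le.1 (ih y)
    have m1 := mono (fun y => (c - a) + g y) (fun y => by have := (ih' y).1; simp only [hgdef]; linarith)
      ((integrable_const _).add (hgi _))
    have m2 := mono (fun y => (c + a) - g y) (fun y => by have := (ih' y).2; simp only [hgdef]; linarith)
      ((integrable_const _).sub (hgi _))
    rw [integral_add (integrable_const _) (hgi _), integral_add (integrable_const _) (hgi _),
      hgm, integral_const, integral_const, hmuniv] at m1
    rw [integral_sub (integrable_const _) (hgi _), integral_sub (integrable_const _) (hgi _),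
      hgm, integral_const, integral_const, hmuniv] at m2
    simp only [smul_eq_mul, probReal_univ, one_mul] at m1 m2
    rw [hstep, pow_succ, abs_le, ← hc]
    rw [← hac] at m1 m2
    constructor <;> nlinarith

/-- Proposition 2 (combined bound for the inexact IMHR algorithm): let `π`, `π̄` be
everywhere-positive probability densities on `ℝ^d` with `π/π̄ ≥ δ > 0`, let `q` be a
probability measure with `μ_π ≪ q` and `‖q − μ_π‖_TV ≤ ε`, let `P̄` be the kernel
`P̄(x, A) = ∫_A min(1, π̄(y)π(x)/(π̄(x)π(y))) q(dy)
          + 1_A(x)·(1 − ∫ min(1, π̄(z)π(x)/(π̄(x)π(z))) q(dz))`,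
and let `C = ∫ (π̄/π) dq ∈ (0, ∞)`. Then for every `x` and every `k ≥ 0`,
`‖P̄^k(x,·) − μ_{π̄}‖_TV ≤ (1 − Cδ)^k + (1 + 1/(Cδ))·ε/δ`; moreover
`1 − 2ε/δ ≤ C ≤ 1 + 2ε/δ`. -/
theorem stmt13 {d : ℕ} (hd : 1 ≤ d) (p pb : EuclideanSpace ℝ (Fin d) → ℝ)
    (hpmeas : Measurable p) (hpbmeas : Measurable pb)
    (hppos : ∀ x, 0 < p x) (hpbpos : ∀ x, 0 < pb x)
    (hpint : ∫ x : EuclideanSpace ℝ (Fin d), p x = 1)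
    (hpbint : ∫ x : EuclideanSpace ℝ (Fin d), pb x = 1)
    (δ : ℝ) (hδ : 0 < δ) (hratio : ∀ x, δ ≤ p x / pb x)
    (q : Measure (EuclideanSpace ℝ (Fin d))) [IsProbabilityMeasure q]
    (hac : (volume.withDensity (fun x => ENNReal.ofReal (p x))) ≪ q)
    (ε : ℝ) (hε : 0 ≤ ε)
    (hqtv : tvDist q (volume.withDensity (fun x => ENNReal.ofReal (p x))) ≤ ε)
    (P : Kernel (EuclideanSpace ℝ (Fin d)) (EuclideanSpace ℝ (Fin d)))
    [IsMarkovKernel P]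
    (hP : ∀ (x : EuclideanSpace ℝ (Fin d)) (A : Set (EuclideanSpace ℝ (Fin d))),
      MeasurableSet A →
      (P x A).toReal =
        (∫ y in A, min 1 (pb y * p x / (pb x * p y)) ∂q) +
          A.indicator (fun _ => (1 : ℝ)) x *
            (1 - ∫ z, min 1 (pb z * p x / (pb x * p z)) ∂q))
    (hint : Integrable (fun x => pb x / p x) q)
    (C : ℝ) (hC : C = ∫ x, pb x / p x ∂q) (hCpos : 0 < C) :
    (∀ (x : EuclideanSpace ℝ (Fin d)) (k : ℕ),
        tvDist (kIter P k x) (volume.withDensity (fun y => ENNReal.ofReal (pb y))) ≤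
          (1 - C * δ) ^ k + (1 + 1 / (C * δ)) * ε / δ) ∧
      1 - 2 * ε / δ ≤ C ∧ C ≤ 1 + 2 * ε / δ := by
  have hpi : Integrable p volume := by
    by_contra h
    rw [integral_undef h] at hpint
    exact zero_ne_one hpint
  have hpbi : Integrable pb volume := by
    by_contra h
    rw [integral_undef h] at hpbint
    exact zero_ne_one hpbint
  have prob : ∀ f : EuclideanSpace ℝ (Fin d) → ℝ, (∀ x, 0 < f x) → Integrable f volume →
      ∫ x, f x = 1 → IsProbabilityMeasure (volume.withDensity (fun x => ENNReal.ofReal (f x))) := by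
    intro f hf hfi h1
    refine ⟨?_⟩
    rw [withDensity_apply _ .univ, Measure.restrict_univ, ← ofReal_integral_eq_lintegral_ofReal hfi
      (Filter.Eventually.of_forall fun x => (hf x).le), h1, ENNReal.ofReal_one]
  haveI i1 := prob p hppos hpi hpint
  haveI i2 := prob pb hpbpos hpbi hpbint
  set μp := volume.withDensity (fun x => ENNReal.ofReal (p x)) with hμp
  set μb := volume.withDensity (fun x => ENNReal.ofReal (pb x)) with hμb
  set w : EuclideanSpace ℝ (Fin d) → ℝ := fun x => pb x / p x with hwdef
  have hw : Measurable w := hpbmeas.div hpmeas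
  have h0 : ∀ x, 0 < w x := fun x => div_pos (hpbpos x) (hppos x)
  have hB : ∀ x, δ * w x ≤ 1 := by
    intro x
    have := hratio x
    rw [le_div_iff₀ (hpbpos x)] at this
    simp only [hwdef]
    rw [← mul_div_assoc, div_le_one (hppos x)]
    exact this
  have hB' : ∀ x, w x ≤ 1 / δ := fun x => by rw [le_div_iff₀ hδ]; linarith [hB x]
  have hmb : μb = μp.withDensity (fun x => ENNReal.ofReal (w x)) := by
    rw [hμp, hμb, ← withDensity_mul _ (by fun_prop) (by fun_prop)]
    congr 1
    ext x
    simp only [Pi.mul_apply, hwdef]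
    rw [← ENNReal.ofReal_mul (hppos x).le, mul_div_cancel₀ _ (hppos x).ne']
  have hwi : Integrable w μp := Integrable.of_bound hw.aestronglyMeasurable (1 / δ)
      (Filter.Eventually.of_forall fun x => by rw [Real.norm_of_nonneg (h0 x).le]; exact hB' x)
  have hbA : ∀ A, MeasurableSet A → μb.real A = ∫ x in A, w x ∂μp := by
    rw [hmb]; exact wd_real μp w hw h0 hwi
  have hdiff : ∀ A, MeasurableSet A →
      |∫ x in A, w x ∂q - ∫ x in A, w x ∂μp| ≤ ε / δ := by
    intro A hA
    have := tv_integral q μp ε hqtv (1 / δ) (by positivity) (A.indicator w) (hw.indicator hA)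
      (fun x => Set.indicator_nonneg (fun y _ => (h0 y).le) x)
      (fun x => by
        by_cases hx : x ∈ A
        · rw [Set.indicator_of_mem hx]; exact hB' x
        · rw [Set.indicator_of_notMem hx]; positivity)
    rw [integral_indicator hA, integral_indicator hA] at this
    refine this.trans (le_of_eq (by ring))
  have hC1 : |C - 1| ≤ ε / δ := by
    have := hdiff Set.univ .univ
    rw [← hbA _ .univ, probReal_univ, Measure.restrict_univ, ← hC] at this
    exact this
  have hεδ : 0 ≤ ε / δ := by positivity
  have hCδ : C * δ ≤ 1 := by
    have := integral_mono hint (integrable_const (1 / δ)) hB'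
    rw [← hC, integral_const, probReal_univ, one_smul, le_div_iff₀ hδ] at this
    exact this
  have hCδ0 : 0 < C * δ := by positivity
  have h2 : 2 * ε / δ = 2 * (ε / δ) := by ring
  have hC1' := abs_le.1 hC1
  refine ⟨fun x k => ?_, by rw [h2]; linarith, by rw [h2]; linarith⟩
  have hP' : ∀ x A, MeasurableSet A →
      (P x A).toReal = (∫ y in A, min 1 (w y / w x) ∂q) +
          A.indicator (fun _ => (1 : ℝ)) x * (1 - ∫ z, min 1 (w z / w x) ∂q) := by
    intro x A hA
    rw [hP x A hA]
    have : ∀ y, pb y * p x / (pb x * p y) = w y / w x := by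
      intro y
      have := (hppos x).ne'
      have := (hppos y).ne'
      have := (hpbpos x).ne'
      simp only [hwdef]
      field_simp
    simp only [this]
  haveI : Nonempty {B : Set (EuclideanSpace ℝ (Fin d)) // MeasurableSet B} := ⟨⟨∅, .empty⟩⟩
  refine ciSup_le fun B => ?_
  obtain ⟨A, hA⟩ := B
  change |(kIter P k x).real A - μb.real A| ≤ _
  have k1 := contraction q w hw h0 δ hδ hB P hP' C hC hCpos A hA k x
  have k2 := hdiff A hA
  rw [← hbA A hA] at k2
  set I := ∫ x in A, w x ∂q with hI
  have hI0 : 0 ≤ I := integral_nonneg fun y => (h0 y).le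
  have hIC : I ≤ C := by
    rw [hC]; exact setIntegral_le_integral hint (Filter.Eventually.of_forall fun y => (h0 y).le)
  have k3 : |I / C - I| ≤ ε / δ := by
    have : I / C - I = -((I / C) * (C - 1)) := by field_simp; ring
    rw [this, abs_neg, abs_mul, abs_of_nonneg (by positivity)]
    calc I / C * |C - 1| ≤ 1 * |C - 1| :=
          mul_le_mul_of_nonneg_right ((div_le_one hCpos).2 hIC) (abs_nonneg _)
      _ ≤ ε / δ := by rw [one_mul]; exact hC1
  have k4 : 2 * (ε / δ) ≤ (1 + 1 / (C * δ)) * ε / δ := by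
    rw [mul_div_assoc]
    refine mul_le_mul_of_nonneg_right ?_ hεδ
    have : 1 ≤ 1 / (C * δ) := by rw [le_div_iff₀ hCδ0]; linarith
    linarith
  rw [abs_le] at *
  constructor <;> linarith [k1.1, k1.2, k2.1, k2.2, k3.1, k3.2]
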